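/- arXiv:2604.20827 — 3 statements merged into one kernel-verified Lean document; each statement's English description precedes it below -/
import Mathlib

section
/- For the discrete block model with Γ^d := {(x,x) : x ∈ X^d} the diagonal, every (x,y) ∈ F^d satisfies I_{Γ^d}(x,y) ≥ b − 2a; in particular inf_{F^d} I_{Γ^d} ≥ b − 2a > 0. Moreover, every (x,y) ∈ F^d satisfies I_{Γ^d}(x,y) ≤ b, so b − 2a ≤ inf_{F^d} I_{Γ^d} ≤ b. -/
open MeasureTheory Filter Set Topology
open scoped ENNReal NNReal Classical

noncomputable section

/-- `m_n := max{2, ⌊e^{κ n}⌋}`. -/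
def mseq (κ : ℝ) (n : ℕ) : ℕ := max 2 ⌊Real.exp (κ * n)⌋₊

/-- `L_n := n ^ 4`. -/
def Lseq (n : ℕ) : ℕ := n ^ 4

/-- `ζ(3) = ∑_{n ≥ 1} n⁻³`. -/
def zeta3 : ℝ := ∑' k : ℕ, (((k : ℝ) + 1) ^ 3)⁻¹

/-- `w_n := (1/ζ(3)) n⁻³`. -/
def wseq (n : ℕ) : ℝ := (1 / zeta3) * ((n : ℝ) ^ 3)⁻¹

/-- The discrete state space `X^d = {(n,i) : n ≥ 1, 0 ≤ i ≤ m_n}` (a countable discrete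
Polish space, as a subtype of `ℕ × ℕ`). -/
abbrev XdT (κ : ℝ) := {p : ℕ × ℕ // 1 ≤ p.1 ∧ p.2 ≤ mseq κ p.1}

lemma one_le_mseq (κ : ℝ) (n : ℕ) : 1 ≤ mseq κ n :=
  le_trans one_le_two (le_max_left _ _)

lemma two_le_mseq (κ : ℝ) (n : ℕ) : 2 ≤ mseq κ n := le_max_left _ _

/-- The measure `μ^d` with `μ^d({(n,i)}) = w_n / (m_n + 1)`. -/
def mud (κ : ℝ) : Measure (XdT κ) :=
  Measure.sum (fun x : XdT κ =>
    ENNReal.ofReal (wseq x.1.1 / ((mseq κ x.1.1 : ℝ) + 1)) • Measure.dirac x)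

/-- The block cost `C^d`. -/
def CdBlock (a b κ : ℝ) (p : XdT κ × XdT κ) : ℝ :=
  if p.1.1.1 = p.2.1.1 then
    (if p.1.1.2 = p.2.1.2 then 0
     else if p.1.1.2 = 0 ∨ p.2.1.2 = 0 then a
     else b)
  else ((Lseq p.1.1.1 : ℝ) + (Lseq p.2.1.1 : ℝ))

/-- The diagonal coupling `P^d_*(x,y) = μ^d(x) 1_{x=y}`. -/
def Pdstar (κ : ℝ) : Measure (XdT κ × XdT κ) := (mud κ).map (fun x => (x, x))

/-- The entropy `H(μ^d) = ∑_x μ^d(x) log(1/μ^d(x))`. -/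
def Hd (κ : ℝ) : ℝ :=
  ∑' x : XdT κ, ((mud κ) {x}).toReal * Real.log (1 / ((mud κ) {x}).toReal)

/-- Relative entropy (Kullback–Leibler divergence). -/
def KL {Ω : Type*} [MeasurableSpace Ω] (P Q : Measure Ω) : EReal :=
  if P ≪ Q ∧ Integrable (fun x => Real.log ((P.rnDeriv Q x).toReal)) P
  then ((∫ x, Real.log ((P.rnDeriv Q x).toReal) ∂P : ℝ) : EReal) else ⊤

/-- Couplings with prescribed marginals. -/
def couplings {X Y : Type*} [MeasurableSpace X] [MeasurableSpace Y]
    (μ : Measure X) (ν : Measure Y) : Set (Measure (X × Y)) :=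
  {P | IsProbabilityMeasure P ∧ P.map Prod.fst = μ ∧ P.map Prod.snd = ν}

/-- Entropic functional. -/
def Jfun {Z : Type*} [MeasurableSpace Z] (C : Z → ℝ) (R : Measure Z) (ε : ℝ)
    (P : Measure Z) : EReal :=
  ((∫⁻ z, ENNReal.ofReal (C z) ∂P : ℝ≥0∞) : EReal) + (ε : EReal) * KL P R

/-- The BGN candidate rate function `I_Γ`. -/
def BGNrate {X Y : Type*} (C : X × Y → ℝ) (Γ : Set (X × Y)) (p : X × Y) : EReal :=
  ⨆ (k : ℕ) (z : Fin (k + 2) → X × Y) (_ : z 0 = p)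
    (_ : ∀ i, i ≠ 0 → z i ∈ Γ) (σ : Equiv.Perm (Fin (k + 2))),
    ((∑ i, C (z i) - ∑ i, C ((z i).1, (z (σ i)).2) : ℝ) : EReal)

/-- The test set `F^d = ⋃_{n ≥ 1} {((n,i),(n,j)) : 1 ≤ i ≠ j ≤ m_n}`. -/
def FdSet (κ : ℝ) : Set (XdT κ × XdT κ) :=
  {p | p.1.1.1 = p.2.1.1 ∧ 1 ≤ p.1.1.2 ∧ 1 ≤ p.2.1.2 ∧ p.1.1.2 ≠ p.2.1.2}

/-- The block cost is nonnegative when its two parameters are. -/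
lemma CdBlock_nonneg {a b : ℝ} (κ : ℝ) (ha : 0 ≤ a) (hb : 0 ≤ b) (p : XdT κ × XdT κ) :
    0 ≤ CdBlock a b κ p := by
  unfold CdBlock
  split_ifs <;> positivity

lemma CdBlock_diag (a b κ : ℝ) (x : XdT κ) : CdBlock a b κ (x, x) = 0 := by
  simp [CdBlock]

lemma CdBlock_of_mem_FdSet (a b : ℝ) {κ : ℝ} {p : XdT κ × XdT κ} (hp : p ∈ FdSet κ) :
    CdBlock a b κ p = b := by
  obtain ⟨h1, h2, h3, h4⟩ := hp
  have h5 : ¬(p.1.1.2 = 0 ∨ p.2.1.2 = 0) := by omega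
  rw [CdBlock, if_pos h1, if_neg h4, if_neg h5]

/-- Over the diagonal, the BGN rate of a nonnegative cost vanishing on the diagonal is at most
the cost. -/
lemma BGNrate_diagonal_le {X : Type*} {C : X × X → ℝ} (hC : ∀ p, 0 ≤ C p)
    (hdiag : ∀ x, C (x, x) = 0) (p : X × X) :
    BGNrate C {q : X × X | q.1 = q.2} p ≤ (C p : EReal) := by
  refine iSup_le fun k => iSup_le fun z => iSup_le fun hz0 => iSup_le fun hz => iSup_le fun σ => ?_
  have hsum : ∑ i, C (z i) = C p := by
    rw [Finset.sum_eq_single 0, hz0]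
    · intro i _ hi
      have h : (z i).1 = (z i).2 := hz i hi
      have hzi : z i = ((z i).1, (z i).1) := Prod.ext rfl h.symm
      rw [hzi, hdiag]
    · simp
  have hnonneg : 0 ≤ ∑ i, C ((z i).1, (z (σ i)).2) := Finset.sum_nonneg fun i _ => hC _
  exact EReal.coe_le_coe_iff.2 (by linarith)

/-- Lower bound for the BGN rate obtained by swapping with one diagonal point. -/
lemma le_BGNrate_diagonal {X : Type*} {C : X × X → ℝ} (p : X × X) (w : X) :
    ((C p + C (w, w) - (C (p.1, w) + C (w, p.2)) : ℝ) : EReal) ≤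
      BGNrate C {q : X × X | q.1 = q.2} p := by
  have hz : ∀ i : Fin (0 + 2), i ≠ 0 →
      (![p, (w, w)] : Fin (0 + 2) → X × X) i ∈ {q : X × X | q.1 = q.2} := by
    intro i hi
    fin_cases i
    · exact absurd rfl hi
    · rfl
  refine le_iSup_of_le 0 (le_iSup_of_le ![p, (w, w)] (le_iSup_of_le rfl
    (le_iSup_of_le hz (le_iSup_of_le (Equiv.swap 0 1) ?_))))
  simp [Fin.sum_univ_two]

lemma le_BGNrate_of_mem_FdSet (a b : ℝ) {κ : ℝ} {p : XdT κ × XdT κ} (hp : p ∈ FdSet κ) :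
    ((b - 2 * a : ℝ) : EReal) ≤
      BGNrate (CdBlock a b κ) {q : XdT κ × XdT κ | q.1 = q.2} p := by
  obtain ⟨h1, h2, h3, h4⟩ := id hp
  let w : XdT κ := ⟨(p.1.1.1, 0), p.1.2.1, Nat.zero_le _⟩
  have hxw : CdBlock a b κ (p.1, w) = a := by
    simp [CdBlock, w, Nat.one_le_iff_ne_zero.1 h2]
  have hwy : CdBlock a b κ (w, p.2) = a := by
    simp [CdBlock, w, h1, (Nat.one_le_iff_ne_zero.1 h3).symm]
  have h := le_BGNrate_diagonal (C := CdBlock a b κ) p w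
  rw [CdBlock_of_mem_FdSet a b hp, CdBlock_diag, hxw, hwy, add_zero, ← two_mul] at h
  exact h

lemma FdSet_nonempty (κ : ℝ) : (FdSet κ).Nonempty :=
  ⟨(⟨(1, 1), le_rfl, one_le_mseq κ 1⟩, ⟨(1, 2), le_rfl, two_le_mseq κ 1⟩), by simp [FdSet]⟩

/-- **Bounds for the BGN rate on `F^d`** (Lemma 3.7 and the remark following it): with
`Γ^d` the diagonal, every `(x,y) ∈ F^d` satisfies `b − 2a ≤ I_{Γ^d}(x,y) ≤ b`; in
particular `b − 2a ≤ inf_{F^d} I_{Γ^d} ≤ b` and `inf_{F^d} I_{Γ^d} > 0`. -/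
theorem BGN_rate_bounds_on_Fd
    (a b κ : ℝ) (ha : 0 < a) (haκ : 2 * a < κ) (hκb : κ < b) :
    (∀ p ∈ FdSet κ,
      ((b - 2 * a : ℝ) : EReal) ≤
        BGNrate (CdBlock a b κ) {q : XdT κ × XdT κ | q.1 = q.2} p) ∧
    (∀ p ∈ FdSet κ,
      BGNrate (CdBlock a b κ) {q : XdT κ × XdT κ | q.1 = q.2} p ≤ ((b : ℝ) : EReal)) ∧
    ((b - 2 * a : ℝ) : EReal) ≤
      (⨅ p ∈ FdSet κ, BGNrate (CdBlock a b κ) {q : XdT κ × XdT κ | q.1 = q.2} p) ∧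
    (0 : EReal) <
      (⨅ p ∈ FdSet κ, BGNrate (CdBlock a b κ) {q : XdT κ × XdT κ | q.1 = q.2} p) ∧
    (⨅ p ∈ FdSet κ, BGNrate (CdBlock a b κ) {q : XdT κ × XdT κ | q.1 = q.2} p) ≤
      ((b : ℝ) : EReal) := by
  have hlower := fun p (hp : p ∈ FdSet κ) => le_BGNrate_of_mem_FdSet a b hp
  have hupper : ∀ p ∈ FdSet κ,
      BGNrate (CdBlock a b κ) {q : XdT κ × XdT κ | q.1 = q.2} p ≤ ((b : ℝ) : EReal) := by
    intro p hp
    have h := BGNrate_diagonal_le (CdBlock_nonneg κ ha.le (by linarith : 0 ≤ b))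
      (CdBlock_diag a b κ) p
    rwa [CdBlock_of_mem_FdSet a b hp] at h
  have hpos : (0 : EReal) < ((b - 2 * a : ℝ) : EReal) := EReal.coe_pos.2 (by linarith)
  obtain ⟨p, hp⟩ := FdSet_nonempty κ
  exact ⟨hlower, hupper, le_iInf₂ hlower, hpos.trans_le (le_iInf₂ hlower),
    (iInf₂_le p hp).trans (hupper p hp)⟩

end
end

section
/- For the continuous block model, the measure P* := ∑_{α} μ^d(α)·(λ_α ⊗ λ_α) belongs to Π(μ,μ), satisfies ∫ C dP* = 0 (hence P* is an optimal transport plan for (μ,μ,C)), and KL(P* ‖ μ⊗μ) = ∑_{α} μ^d(α) log(1/μ^d(α)) < ∞; in particular J_ε(P*) < ∞ for every ε > 0. -/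
open MeasureTheory Filter Set Topology
open scoped ENNReal NNReal Classical

noncomputable section

/-- `M_1 := 0`, `M_{n+1} := M_n + 3(m_n + 1)`. -/
def Mseq (κ : ℝ) : ℕ → ℝ
  | 0 => 0
  | 1 => 0
  | (n + 2) => Mseq κ (n + 1) + 3 * ((mseq κ (n + 1) : ℝ) + 1)

/-- The interval `I_{n,i} := [M_n + 3i, M_n + 3i + 1]`. -/
def Iab (κ : ℝ) (n i : ℕ) : Set ℝ :=
  Set.Icc (Mseq κ n + 3 * i) (Mseq κ n + 3 * i + 1)

/-- The ambient space `X := ⋃_{n ≥ 1} ⋃_{0 ≤ i ≤ m_n} I_{n,i}`. -/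
def Xset (κ : ℝ) : Set ℝ :=
  ⋃ (n : ℕ) (_ : 1 ≤ n) (i : ℕ) (_ : i ≤ mseq κ n), Iab κ n i

/-- The set of valid labels `(n,i)` with `n ≥ 1`, `0 ≤ i ≤ m_n`. -/
def validLabel (κ : ℝ) (p : ℕ × ℕ) : Prop := 1 ≤ p.1 ∧ p.2 ≤ mseq κ p.1

/-- `λ_{n,i}`: Lebesgue measure restricted to `I_{n,i}` (a probability measure since
`|I_{n,i}| = 1`). -/
def lam (κ : ℝ) (n i : ℕ) : Measure ℝ := volume.restrict (Iab κ n i)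

/-- The nonatomic marginal `μ := ∑_{n ≥ 1} ∑_{i=0}^{m_n} (w_n/(m_n+1)) λ_{n,i}`. -/
def muC (κ : ℝ) : Measure ℝ :=
  Measure.sum (fun p : ℕ × ℕ =>
    if validLabel κ p then
      ENNReal.ofReal (wseq p.1 / ((mseq κ p.1 : ℝ) + 1)) • lam κ p.1 p.2
    else 0)

/-- The label map `ℓ : X → X^d` (junk value `(0,0)` off `X`). -/
def labl (κ : ℝ) (x : ℝ) : ℕ × ℕ :=
  if h : ∃ p : ℕ × ℕ, validLabel κ p ∧ x ∈ Iab κ p.1 p.2 then h.choose else (0, 0)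

/-- The discrete block cost on labels. -/
def CdPair (a b : ℝ) (p q : ℕ × ℕ) : ℝ :=
  if p.1 = q.1 then (if p.2 = q.2 then 0 else if p.2 = 0 ∨ q.2 = 0 then a else b)
  else ((Lseq p.1 : ℝ) + (Lseq q.1 : ℝ))

/-- The continuous cost `C(x,y) := C^d(ℓ(x), ℓ(y))`. -/
def Ccont (a b κ : ℝ) (p : ℝ × ℝ) : ℝ := CdPair a b (labl κ p.1) (labl κ p.2)

/-- The block-product plan `P^* := ∑_α μ^d(α) (λ_α ⊗ λ_α)`. -/
def PstarC (κ : ℝ) : Measure (ℝ × ℝ) :=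
  Measure.sum (fun p : ℕ × ℕ =>
    if validLabel κ p then
      ENNReal.ofReal (wseq p.1 / ((mseq κ p.1 : ℝ) + 1)) •
        ((lam κ p.1 p.2).prod (lam κ p.1 p.2))
    else 0)

/-- The mixture `∑ i, w i • ν i` of a family of measures. -/
def mixture {ι Ω : Type*} [MeasurableSpace Ω] (w : ι → ℝ) (ν : ι → Measure Ω) : Measure Ω :=
  Measure.sum fun i => ENNReal.ofReal (w i) • ν i

lemma tsum_indicator_prod_self_apply {ι Ω : Type*} {S : ι → Set Ω}
    (hdisj : Pairwise (Function.onFun Disjoint S)) (c : ι → ℝ≥0∞)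
    {i : ι} {z : Ω × Ω} (hz : z ∈ S i ×ˢ S i) :
    (∑' j, (S j ×ˢ S j).indicator fun _ => c j) z = c i := by
  rw [tsum_apply (Pi.summable.2 fun _ => ENNReal.summable), tsum_eq_single i]
  · exact indicator_of_mem hz _
  · intro j hj
    exact indicator_of_notMem (fun hzj => Set.disjoint_left.1 (hdisj hj) hzj.1 hz.1) _

section Mixture

variable {ι Ω : Type*} [MeasurableSpace Ω] {w : ι → ℝ} {ν : ι → Measure Ω} {S : ι → Set Ω}

lemma isProbabilityMeasure_mixture [∀ i, IsProbabilityMeasure (ν i)]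
    (hw : ∀ i, 0 ≤ w i) (hsum : HasSum w 1) : IsProbabilityMeasure (mixture w ν) := by
  constructor
  rw [mixture, Measure.sum_apply _ MeasurableSet.univ]
  simp only [Measure.smul_apply, measure_univ, smul_eq_mul, mul_one]
  rw [← ENNReal.ofReal_tsum_of_nonneg hw hsum.summable, hsum.tsum_eq, ENNReal.ofReal_one]

lemma map_fst_mixture_prod_self [∀ i, IsProbabilityMeasure (ν i)] :
    (mixture w fun i => (ν i).prod (ν i)).map Prod.fst = mixture w ν := by
  rw [mixture, Measure.map_sum measurable_fst.aemeasurable, mixture]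
  simp [Measure.map_smul]

lemma map_snd_mixture_prod_self [∀ i, IsProbabilityMeasure (ν i)] :
    (mixture w fun i => (ν i).prod (ν i)).map Prod.snd = mixture w ν := by
  rw [mixture, Measure.map_sum measurable_snd.aemeasurable, mixture]
  simp [Measure.map_smul]

lemma ae_mixture_of_forall_ae [Countable ι] {p : Ω → Prop} (h : ∀ i, ∀ᵐ x ∂ν i, p x) :
    ∀ᵐ x ∂mixture w ν, p x :=
  Measure.ae_sum_iff.2 fun i => Measure.ae_smul_measure (h i) _

lemma ae_of_ae_mixture [Countable ι] {p : Ω → Prop} (h : ∀ᵐ x ∂mixture w ν, p x) {i : ι}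
    (hw : 0 < w i) : ∀ᵐ x ∂ν i, p x :=
  (Measure.ae_ennreal_smul_measure_iff (ENNReal.ofReal_pos.2 hw).ne').1
    (Measure.ae_sum_iff.1 h i)

lemma ae_mem_prod_self [∀ i, SFinite (ν i)] (hν : ∀ i, ∀ᵐ x ∂ν i, x ∈ S i) (i : ι) :
    ∀ᵐ z ∂(ν i).prod (ν i), z ∈ S i ×ˢ S i := by
  filter_upwards [Measure.quasiMeasurePreserving_fst.ae (hν i),
    Measure.quasiMeasurePreserving_snd.ae (hν i)] with z h₁ h₂ using ⟨h₁, h₂⟩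

lemma restrict_mixture (hS : ∀ i, MeasurableSet (S i))
    (hdisj : Pairwise (Function.onFun Disjoint S)) (hν : ∀ i, ∀ᵐ x ∂ν i, x ∈ S i) (i : ι) :
    (mixture w ν).restrict (S i) = ENNReal.ofReal (w i) • ν i := by
  have hzero : ∀ j, j ≠ i → (ν j).restrict (S i) = 0 := fun j hj => by
    rw [Measure.restrict_eq_zero]
    refine measure_mono_null (fun x hx => ?_) (hν j)
    exact fun hxj => Set.disjoint_left.1 (hdisj hj) hxj hx
  have hself : (ν i).restrict (S i) = ν i := Measure.restrict_eq_self_of_ae_mem (hν i)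
  rw [mixture, Measure.restrict_sum _ (hS i)]
  ext t ht
  rw [Measure.sum_apply _ ht, tsum_eq_single i]
  · rw [Measure.restrict_smul, hself]
  · intro j hj
    rw [Measure.restrict_smul, hzero j hj]
    simp

lemma mixture_prod_self_eq_withDensity [Countable ι] [∀ i, IsProbabilityMeasure (ν i)]
    (hw : ∀ i, 0 < w i) (hsum : HasSum w 1) (hS : ∀ i, MeasurableSet (S i))
    (hdisj : Pairwise (Function.onFun Disjoint S)) (hν : ∀ i, ∀ᵐ x ∂ν i, x ∈ S i) :
    (mixture w fun i => (ν i).prod (ν i)) = ((mixture w ν).prod (mixture w ν)).withDensity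
      (∑' i, (S i ×ˢ S i).indicator fun _ => (ENNReal.ofReal (w i))⁻¹) := by
  have := isProbabilityMeasure_mixture (ν := ν) (fun i => (hw i).le) hsum
  rw [withDensity_tsum fun i => measurable_const.indicator ((hS i).prod (hS i)), mixture]
  congr 1
  ext1 i
  have h0 : ENNReal.ofReal (w i) ≠ 0 := (ENNReal.ofReal_pos.2 (hw i)).ne'
  rw [withDensity_indicator ((hS i).prod (hS i)), withDensity_const, ← Measure.prod_restrict,
    restrict_mixture hS hdisj hν, Measure.prod_smul_left, Measure.prod_smul_right, smul_smul,
    smul_smul, ENNReal.inv_mul_cancel h0 ENNReal.ofReal_ne_top, one_mul]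

lemma KL_mixture_prod_self [Countable ι] [∀ i, IsProbabilityMeasure (ν i)]
    (hw : ∀ i, 0 < w i) (hsum : HasSum w 1) (hS : ∀ i, MeasurableSet (S i))
    (hdisj : Pairwise (Function.onFun Disjoint S)) (hν : ∀ i, ∀ᵐ x ∂ν i, x ∈ S i)
    (hent : Summable fun i => w i * Real.log (1 / w i)) :
    KL (mixture w fun i => (ν i).prod (ν i)) ((mixture w ν).prod (mixture w ν)) =
      ((∑' i, w i * Real.log (1 / w i) : ℝ) : EReal) := by
  have := isProbabilityMeasure_mixture (ν := ν) (fun i => (hw i).le) hsum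
  set P := mixture w fun i => (ν i).prod (ν i) with hP
  set Q := (mixture w ν).prod (mixture w ν) with hQ
  have hPQ := mixture_prod_self_eq_withDensity hw hsum hS hdisj hν
  rw [← hP, ← hQ] at hPQ
  have hac : P ≪ Q := hPQ ▸ withDensity_absolutelyContinuous _ _
  have hmeas : Measurable
      (∑' i, (S i ×ˢ S i).indicator fun _ => (ENNReal.ofReal (w i))⁻¹ : Ω × Ω → ℝ≥0∞) :=
    Measurable.tsum' fun i => measurable_const.indicator ((hS i).prod (hS i))
  have hrn := hac.ae_le (hPQ ▸ Measure.rnDeriv_withDensity Q hmeas)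
  have hlog : ∀ i, (fun z => Real.log ((P.rnDeriv Q z).toReal)) =ᵐ[(ν i).prod (ν i)]
      fun _ => Real.log (1 / w i) := fun i => by
    filter_upwards [ae_of_ae_mixture hrn (hw i), ae_mem_prod_self hν i] with z hz hzS
    rw [hz, tsum_indicator_prod_self_apply hdisj _ hzS, ENNReal.toReal_inv,
      ENNReal.toReal_ofReal (hw i).le, one_div]
  have hpos : ∀ i, 0 ≤ Real.log (1 / w i) := fun i =>
    Real.log_nonneg ((one_le_div (hw i)).2 (le_hasSum hsum i fun j _ => (hw j).le))
  have hint : Integrable (fun z => Real.log ((P.rnDeriv Q z).toReal)) P := by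
    refine integrable_sum_measure (fun i => ?_) ?_
    · exact ((integrable_const _).congr (hlog i).symm).smul_measure ENNReal.ofReal_ne_top
    · convert hent using 2 with i
      rw [integral_smul_measure, integral_congr_ae (g := fun _ => Real.log (1 / w i))
        ((hlog i).mono fun z hz => by simp only [hz, Real.norm_of_nonneg (hpos i)])]
      simp [(hw i).le]
  rw [KL, if_pos ⟨hac, hint⟩]
  refine congrArg _ ((integral_sum_measure hint).trans (tsum_congr fun i => ?_))
  rw [integral_smul_measure, integral_congr_ae (hlog i)]
  simp [(hw i).le]

end Mixture

section Weights

lemma summable_inv_succ_pow_three : Summable fun k : ℕ => (((k : ℝ) + 1) ^ 3)⁻¹ := by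
  have h := (summable_nat_add_iff 1).2 (Real.summable_nat_pow_inv (p := 3).2 (by norm_num))
  simpa using h

lemma zeta3_pos : 0 < zeta3 :=
  summable_inv_succ_pow_three.tsum_pos (fun _ => by positivity) 0 (by norm_num)

lemma wseq_pos {n : ℕ} (hn : 1 ≤ n) : 0 < wseq n := by
  have : (0 : ℝ) < n := by exact_mod_cast hn
  have := zeta3_pos
  unfold wseq
  positivity

lemma wseq_zero : wseq 0 = 0 := by simp [wseq]

lemma hasSum_wseq : HasSum wseq 1 := by
  have h : HasSum (fun k => wseq (k + 1)) 1 := by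
    have := summable_inv_succ_pow_three.hasSum.mul_left (1 / zeta3)
    rw [← zeta3, one_div_mul_cancel zeta3_pos.ne'] at this
    simpa [wseq] using this
  have := (hasSum_nat_add_iff 1).1 h
  simpa [wseq_zero] using this

/-- The mass `μ^d(n,i) = w_n / (m_n + 1)` of a label. -/
def labelWeight (κ : ℝ) (α : {p : ℕ × ℕ // validLabel κ p}) : ℝ :=
  wseq α.1.1 / ((mseq κ α.1.1 : ℝ) + 1)

lemma labelWeight_pos (κ : ℝ) (α : {p : ℕ × ℕ // validLabel κ p}) : 0 < labelWeight κ α :=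
  div_pos (wseq_pos α.2.1) (by positivity)

/-- Summing over valid labels a nonnegative quantity depending only on the block. -/
lemma hasSum_validLabel {κ : ℝ} {g : ℕ → ℝ} {s : ℝ} (hg : ∀ n, 1 ≤ n → 0 ≤ g n)
    (hs : HasSum (fun n => if 1 ≤ n then ((mseq κ n : ℝ) + 1) * g n else 0) s) :
    HasSum (fun α : {p : ℕ × ℕ // validLabel κ p} => g α.1.1) s := by
  let f : ℕ × ℕ → ℝ := {p | validLabel κ p}.indicator fun p => g p.1
  have hf : 0 ≤ f := fun p => indicator_nonneg (fun p hp => hg p.1 hp.1) p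
  have hrow : ∀ n, HasSum (fun i => f (n, i))
      (if 1 ≤ n then ((mseq κ n : ℝ) + 1) * g n else 0) := fun n => by
    by_cases hn : 1 ≤ n
    · have hfin : ∑ i ∈ Finset.range (mseq κ n + 1), f (n, i) = ((mseq κ n : ℝ) + 1) * g n := by
        rw [Finset.sum_congr rfl (g := fun _ => g n)]
        · simp
        · intro i hi
          have hv : (n, i) ∈ {p | validLabel κ p} :=
            ⟨hn, Nat.lt_succ_iff.1 (Finset.mem_range.1 hi)⟩
          exact indicator_of_mem hv _
      rw [if_pos hn, ← hfin]
      refine hasSum_sum_of_ne_finset_zero fun i hi => ?_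
      have hv : (n, i) ∉ {p | validLabel κ p} :=
        fun h => hi (Finset.mem_range.2 (Nat.lt_succ_iff.2 h.2))
      exact indicator_of_notMem hv _
    · rw [if_neg hn]
      convert hasSum_zero (α := ℝ) (β := ℕ) with i
      have hv : (n, i) ∉ {p | validLabel κ p} := fun h => hn h.1
      exact indicator_of_notMem hv _
  have hsum : Summable f := by
    refine (summable_prod_of_nonneg hf).2 ⟨fun n => (hrow n).summable, ?_⟩
    simpa only [(hrow _).tsum_eq] using hs.summable
  have hfs : HasSum f s := by
    have h := hsum.hasSum
    rwa [(h.prod_fiberwise hrow).unique hs] at h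
  exact hasSum_subtype_iff_indicator.2 hfs

lemma hasSum_labelWeight (κ : ℝ) : HasSum (labelWeight κ) 1 := by
  refine hasSum_validLabel (g := fun n => wseq n / ((mseq κ n : ℝ) + 1))
    (fun n hn => div_nonneg (wseq_pos hn).le (by positivity)) ?_
  convert hasSum_wseq using 2 with n
  split_ifs with hn
  · field_simp
  · simp [show n = 0 by omega, wseq_zero]

lemma log_mseq_succ_le {κ : ℝ} (hκ : 0 ≤ κ) (n : ℕ) :
    Real.log ((mseq κ n : ℝ) + 1) ≤ Real.log 4 + κ * n := by
  have h1 : 1 ≤ Real.exp (κ * n) := Real.one_le_exp (by positivity)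
  have h2 : (mseq κ n : ℝ) ≤ 2 * Real.exp (κ * n) := by
    rw [mseq, Nat.cast_max]
    refine max_le (by push_cast; linarith) ?_
    have := Nat.floor_le (Real.exp_pos (κ * n)).le
    linarith
  calc Real.log ((mseq κ n : ℝ) + 1) ≤ Real.log (4 * Real.exp (κ * n)) :=
        Real.log_le_log (by positivity) (by linarith)
    _ = Real.log 4 + κ * n := by
        rw [Real.log_mul (by norm_num) (Real.exp_pos _).ne', Real.log_exp]

lemma log_inv_weight_le {κ : ℝ} (hκ : 0 ≤ κ) {n : ℕ} (hn : 1 ≤ n) :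
    Real.log (1 / (wseq n / ((mseq κ n : ℝ) + 1))) ≤
      (Real.log 4 + κ + |Real.log zeta3| + 3) * n := by
  have hn1 : (1 : ℝ) ≤ n := by exact_mod_cast hn
  have hw := wseq_pos hn
  have hz := zeta3_pos
  have h1 : Real.log (wseq n) = -Real.log zeta3 - 3 * Real.log n := by
    rw [wseq, Real.log_mul (by positivity) (by positivity), one_div, Real.log_inv, Real.log_inv,
      Real.log_pow]
    push_cast
    ring
  have h2 := log_mseq_succ_le hκ n
  have h3 := Real.log_le_sub_one_of_pos (show (0 : ℝ) < n by linarith)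
  have h4 : 0 ≤ Real.log 4 := Real.log_nonneg (by norm_num)
  have h5 := le_abs_self (Real.log zeta3)
  have h6 := abs_nonneg (Real.log zeta3)
  rw [one_div_div, Real.log_div (by positivity) hw.ne', h1]
  nlinarith

lemma summable_labelWeight_mul_log {κ : ℝ} (hκ : 0 ≤ κ) :
    Summable fun α => labelWeight κ α * Real.log (1 / labelWeight κ α) := by
  have hle : ∀ n, 1 ≤ n → wseq n / ((mseq κ n : ℝ) + 1) ≤ 1 := fun n hn =>
    le_hasSum (hasSum_labelWeight κ) ⟨(n, 0), hn, Nat.zero_le _⟩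
      fun α _ => (labelWeight_pos κ α).le
  have hpos : ∀ n, 1 ≤ n → 0 < wseq n / ((mseq κ n : ℝ) + 1) := fun n hn =>
    labelWeight_pos κ ⟨(n, 0), hn, Nat.zero_le _⟩
  have hlog : ∀ n, 1 ≤ n → 0 ≤ Real.log (1 / (wseq n / ((mseq κ n : ℝ) + 1))) := fun n hn =>
    Real.log_nonneg ((one_le_div (hpos n hn)).2 (hle n hn))
  refine (hasSum_validLabel
    (g := fun n => wseq n / ((mseq κ n : ℝ) + 1) *
      Real.log (1 / (wseq n / ((mseq κ n : ℝ) + 1))))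
    (fun n hn => mul_nonneg (hpos n hn).le (hlog n hn)) (Summable.hasSum ?_)).summable
  have hz := zeta3_pos
  set K := Real.log 4 + κ + |Real.log zeta3| + 3
  refine Summable.of_nonneg_of_le (f := fun n : ℕ => 1 / zeta3 * K * ((n : ℝ) ^ 2)⁻¹)
    (fun n => ?_) (fun n => ?_)
    ((Real.summable_nat_pow_inv.2 (by norm_num)).mul_left _)
  · split_ifs with hn
    · exact mul_nonneg (by positivity) (mul_nonneg (hpos n hn).le (hlog n hn))
    · exact le_rfl
  · split_ifs with hn
    · have hn1 : (0 : ℝ) < n := by exact_mod_cast hn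
      calc ((mseq κ n : ℝ) + 1) * (wseq n / ((mseq κ n : ℝ) + 1) *
            Real.log (1 / (wseq n / ((mseq κ n : ℝ) + 1))))
          = wseq n * Real.log (1 / (wseq n / ((mseq κ n : ℝ) + 1))) := by field_simp
        _ ≤ wseq n * (K * n) :=
          mul_le_mul_of_nonneg_left (log_inv_weight_le hκ hn) (wseq_pos hn).le
        _ = 1 / zeta3 * K * ((n : ℝ) ^ 2)⁻¹ := by
          rw [wseq]
          field_simp
    · simp [show n = 0 by omega]

end Weights

section Blocks

lemma Mseq_succ (κ : ℝ) {n : ℕ} (hn : 1 ≤ n) :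
    Mseq κ (n + 1) = Mseq κ n + 3 * ((mseq κ n : ℝ) + 1) := by
  obtain ⟨k, rfl⟩ := Nat.exists_eq_add_of_le' hn
  rfl

lemma Mseq_add_le (κ : ℝ) {n m : ℕ} (hn : 1 ≤ n) (hnm : n < m) :
    Mseq κ n + 3 * ((mseq κ n : ℝ) + 1) ≤ Mseq κ m := by
  induction m, hnm using Nat.le_induction with
  | base => exact (Mseq_succ κ hn).ge
  | succ m hm ih =>
    rw [Mseq_succ κ (by omega : 1 ≤ m)]
    have : (0 : ℝ) ≤ mseq κ m := Nat.cast_nonneg _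
    linarith

lemma validLabel.eq_of_mem_Iab {κ : ℝ} {p q : ℕ × ℕ} (hp : validLabel κ p)
    (hq : validLabel κ q) {x : ℝ} (hxp : x ∈ Iab κ p.1 p.2) (hxq : x ∈ Iab κ q.1 q.2) :
    p = q := by
  have block_le : ∀ {p q : ℕ × ℕ}, validLabel κ p → x ∈ Iab κ p.1 p.2 → x ∈ Iab κ q.1 q.2 →
      ¬ p.1 < q.1 := by
    intro p q hp hxp hxq h
    have h1 := Mseq_add_le κ hp.1 h
    have h2 : (p.2 : ℝ) ≤ mseq κ p.1 := by exact_mod_cast hp.2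
    have h3 : (0 : ℝ) ≤ q.2 := Nat.cast_nonneg _
    linarith [hxp.2, hxq.1]
  have hfst : p.1 = q.1 :=
    le_antisymm (not_lt.1 (block_le hq hxq hxp)) (not_lt.1 (block_le hp hxp hxq))
  refine Prod.ext hfst ?_
  obtain ⟨h1, h2⟩ := hxp
  obtain ⟨h3, h4⟩ := hxq
  rw [hfst] at h1 h2
  have h5 : (p.2 : ℝ) < q.2 + 1 := by linarith
  have h6 : (q.2 : ℝ) < p.2 + 1 := by linarith
  norm_cast at h5 h6
  omega

lemma labl_eq {κ : ℝ} {p : ℕ × ℕ} (hp : validLabel κ p) {x : ℝ} (hx : x ∈ Iab κ p.1 p.2) :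
    labl κ x = p := by
  have h : ∃ p : ℕ × ℕ, validLabel κ p ∧ x ∈ Iab κ p.1 p.2 := ⟨p, hp, hx⟩
  rw [labl, dif_pos h]
  exact h.choose_spec.1.eq_of_mem_Iab hp h.choose_spec.2 hx

instance isProbabilityMeasure_lam (κ : ℝ) (n i : ℕ) : IsProbabilityMeasure (lam κ n i) :=
  ⟨by simp [lam, Iab]⟩

lemma sum_ite_validLabel {Ω : Type*} [MeasurableSpace Ω] (κ : ℝ) (ν : ℕ × ℕ → Measure Ω) :
    (Measure.sum fun p : ℕ × ℕ => if validLabel κ p then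
      ENNReal.ofReal (wseq p.1 / ((mseq κ p.1 : ℝ) + 1)) • ν p else 0) =
      mixture (labelWeight κ) fun α => ν α.1 := by
  ext s hs
  rw [mixture, Measure.sum_apply _ hs, Measure.sum_apply _ hs]
  refine Eq.trans ?_ (tsum_subtype {p | validLabel κ p} fun p =>
    (ENNReal.ofReal (wseq p.1 / ((mseq κ p.1 : ℝ) + 1)) • ν p) s).symm
  congr 1
  ext1 p
  by_cases hp : validLabel κ p <;> simp [hp]

lemma muC_eq_mixture (κ : ℝ) :
    muC κ = mixture (labelWeight κ) fun α => lam κ α.1.1 α.1.2 :=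
  sum_ite_validLabel κ fun p => lam κ p.1 p.2

lemma PstarC_eq_mixture (κ : ℝ) :
    PstarC κ = mixture (labelWeight κ)
      fun α => (lam κ α.1.1 α.1.2).prod (lam κ α.1.1 α.1.2) :=
  sum_ite_validLabel κ fun p => (lam κ p.1 p.2).prod (lam κ p.1 p.2)

lemma ae_mem_Iab (κ : ℝ) (n i : ℕ) : ∀ᵐ x ∂lam κ n i, x ∈ Iab κ n i :=
  ae_restrict_mem measurableSet_Icc

lemma pairwise_disjoint_Iab (κ : ℝ) :
    Pairwise (Function.onFun Disjoint fun α : {p : ℕ × ℕ // validLabel κ p} => Iab κ α.1.1 α.1.2) :=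
  fun α β hαβ => Set.disjoint_left.2 fun _ hα hβ =>
    hαβ (Subtype.ext (α.2.eq_of_mem_Iab β.2 hα hβ))

lemma PstarC_mem_couplings (κ : ℝ) : PstarC κ ∈ couplings (muC κ) (muC κ) := by
  rw [PstarC_eq_mixture, muC_eq_mixture]
  exact ⟨isProbabilityMeasure_mixture (fun α => (labelWeight_pos κ α).le) (hasSum_labelWeight κ),
    map_fst_mixture_prod_self, map_snd_mixture_prod_self⟩

lemma Ccont_ae_eq_zero (a b κ : ℝ) : ∀ᵐ z ∂PstarC κ, Ccont a b κ z = 0 := by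
  rw [PstarC_eq_mixture]
  refine ae_mixture_of_forall_ae fun α => ?_
  filter_upwards [ae_mem_prod_self (fun α : {p : ℕ × ℕ // validLabel κ p} =>
    ae_mem_Iab κ α.1.1 α.1.2) α] with z hz
  rw [Ccont, labl_eq α.2 hz.1, labl_eq α.2 hz.2]
  simp [CdPair]

lemma lintegral_Ccont_PstarC (a b κ : ℝ) :
    ∫⁻ p, ENNReal.ofReal (Ccont a b κ p) ∂PstarC κ = 0 := by
  rw [lintegral_congr_ae ((Ccont_ae_eq_zero a b κ).mono fun z hz =>
    show ENNReal.ofReal (Ccont a b κ z) = (fun _ => 0) z by simp [hz]), lintegral_zero]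

lemma KL_PstarC {κ : ℝ} (hκ : 0 ≤ κ) :
    KL (PstarC κ) ((muC κ).prod (muC κ)) =
      ((∑' α, labelWeight κ α * Real.log (1 / labelWeight κ α) : ℝ) : EReal) := by
  rw [PstarC_eq_mixture, muC_eq_mixture]
  exact KL_mixture_prod_self (labelWeight_pos κ) (hasSum_labelWeight κ)
    (fun _ => measurableSet_Icc) (pairwise_disjoint_Iab κ) (fun α => ae_mem_Iab κ α.1.1 α.1.2)
    (summable_labelWeight_mul_log hκ)

end Blocks

/-- **Finite entropy and optimality of `P^*`** (Lemma 4.2): `P^* ∈ Π(μ,μ)`,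
`∫ C dP^* = 0` (so `P^*` is an optimal transport plan for `(μ, μ, C)`), and
`KL(P^* ‖ μ⊗μ) = ∑_α μ^d(α) log(1/μ^d(α)) < ∞`; in particular `J_ε(P^*) < ∞` for all
`ε > 0`. -/
theorem block_product_plan_finite_entropy_and_optimal
    (a b κ : ℝ) (ha : 0 < a) (haκ : 2 * a < κ) (hκb : κ < b) :
    PstarC κ ∈ couplings (muC κ) (muC κ) ∧
    (∫⁻ p, ENNReal.ofReal (Ccont a b κ p) ∂(PstarC κ)) = 0 ∧
    (∀ Q ∈ couplings (muC κ) (muC κ),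
      (∫⁻ p, ENNReal.ofReal (Ccont a b κ p) ∂(PstarC κ)) ≤
        ∫⁻ p, ENNReal.ofReal (Ccont a b κ p) ∂Q) ∧
    Summable (fun α : {p : ℕ × ℕ // validLabel κ p} =>
      (wseq α.1.1 / ((mseq κ α.1.1 : ℝ) + 1)) *
        Real.log (1 / (wseq α.1.1 / ((mseq κ α.1.1 : ℝ) + 1)))) ∧
    KL (PstarC κ) ((muC κ).prod (muC κ)) =
      ((∑' α : {p : ℕ × ℕ // validLabel κ p},
        (wseq α.1.1 / ((mseq κ α.1.1 : ℝ) + 1)) *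
          Real.log (1 / (wseq α.1.1 / ((mseq κ α.1.1 : ℝ) + 1))) : ℝ) : EReal) ∧
    (∀ ε : ℝ, 0 < ε →
      Jfun (Ccont a b κ) ((muC κ).prod (muC κ)) ε (PstarC κ) < (⊤ : EReal)) := by
  have hκ : 0 ≤ κ := by linarith
  have hcost := lintegral_Ccont_PstarC a b κ
  refine ⟨PstarC_mem_couplings κ, hcost, fun Q _ => hcost.le.trans zero_le,
    summable_labelWeight_mul_log hκ, KL_PstarC hκ, fun ε _ => ?_⟩
  rw [Jfun, hcost, KL_PstarC hκ, ← EReal.coe_mul, EReal.coe_ennreal_zero, zero_add]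
  exact EReal.coe_lt_top _

end
end

section
/- Let X be a Polish space partitioned into countably many pairwise disjoint Borel sets (I_α)_{α∈A}, let λ_α be a probability measure concentrated on I_α, and let μ := ∑_α m_α λ_α with m_α ≥ 0, ∑_α m_α = 1; let ℓ : X → A be the label map and let Ĉ : A × A → [0,∞) induce the cost C(x,y) := Ĉ(ℓ(x),ℓ(y)). For P ∈ Π(μ,μ) set P̂ := (ℓ×ℓ)_#P. Then: (1) ∫ C dP = ∑_{α,β} Ĉ(α,β)·P̂(α,β); (2) KL(P ‖ μ⊗μ) ≥ KL(P̂ ‖ μ̂⊗μ̂), where μ̂ := ℓ_#μ; (3) if KL(P ‖ μ⊗μ) < ∞, then KL(P ‖ μ⊗μ) = KL(P̂ ‖ μ̂⊗μ̂) + ∑_{α,β : P̂(α,β)>0} P̂(α,β)·KL(P^{αβ} ‖ λ_α⊗λ_β), where P^{αβ} is the conditional probability of P on I_α × I_β, and equality KL(P ‖ μ⊗μ) = KL(P̂ ‖ μ̂⊗μ̂) holds if and only if P^{αβ} = λ_α⊗λ_β for every (α,β) with P̂(α,β) > 0. -/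
open MeasureTheory Filter Set Topology
open scoped ENNReal NNReal Classical

noncomputable section

/-- Clamp an extended real to `ℝ≥0∞`. -/
def erealToENNReal (x : EReal) : ℝ≥0∞ := if x = ⊤ then ⊤ else ENNReal.ofReal x.toReal

open InformationTheory

lemma klDiv_withDensity {Ω : Type*} [MeasurableSpace Ω] (ν : Measure Ω) [IsFiniteMeasure ν]
    {f : Ω → ℝ≥0∞} (hf : Measurable f) (hfin : ∫⁻ x, f x ∂ν ≠ ⊤) :
    klDiv (ν.withDensity f) ν = ∫⁻ x, ENNReal.ofReal (klFun (f x).toReal) ∂ν := by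
  have := isFiniteMeasure_withDensity hfin
  rw [klDiv_eq_lintegral_klFun_of_ac (withDensity_absolutelyContinuous ν f)]
  refine lintegral_congr_ae ?_
  filter_upwards [Measure.rnDeriv_withDensity ν hf] with x hx
  rw [hx]

/-- Scaling identity for `klFun`, with the logarithm split into its positive and negative parts
so that every summand is nonnegative. -/
lemma ofReal_klFun_mul_add {s y : ℝ} (hs : 0 < s) (hy : 0 ≤ y) :
    ENNReal.ofReal (klFun (s * y)) +
        (ENNReal.ofReal (s * (Real.log s)⁺) + ENNReal.ofReal (s * (Real.log s)⁻) *
          ENNReal.ofReal y) =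
      ENNReal.ofReal (klFun s) + ENNReal.ofReal s * ENNReal.ofReal (klFun y) +
        (ENNReal.ofReal (s * (Real.log s)⁺) * ENNReal.ofReal y +
          ENNReal.ofReal (s * (Real.log s)⁻)) := by
  have h1 := klFun_nonneg (mul_nonneg hs.le hy)
  have h2 := klFun_nonneg hs.le
  have h3 := klFun_nonneg hy
  have h4 := mul_nonneg hs.le (posPart_nonneg (Real.log s))
  have h5 := mul_nonneg hs.le (negPart_nonneg (Real.log s))
  rw [← ENNReal.ofReal_mul h5, ← ENNReal.ofReal_mul h4, ← ENNReal.ofReal_mul hs.le,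
    ← ENNReal.ofReal_add h4 (by positivity), ← ENNReal.ofReal_add h1 (by positivity),
    ← ENNReal.ofReal_add h2 (by positivity), ← ENNReal.ofReal_add (by positivity) h5,
    ← ENNReal.ofReal_add (by positivity) (by positivity)]
  congr 1
  have hlog : Real.log s = (Real.log s)⁺ - (Real.log s)⁻ := (posPart_sub_negPart _).symm
  simp only [klFun_apply]
  rcases hy.eq_or_lt with rfl | hy
  · simp only [mul_zero, zero_mul, sub_zero, zero_add, add_zero]
    linear_combination (-s) * hlog
  · rw [Real.log_mul hs.ne' hy.ne']
    linear_combination (s * y - s) * hlog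

lemma lintegral_klFun_eq_add {Ω : Type*} [MeasurableSpace Ω] (Λ : Measure Ω)
    [IsProbabilityMeasure Λ] {f : Ω → ℝ≥0∞} (hf : Measurable f) {s : ℝ≥0∞}
    (hs : ∫⁻ x, f x ∂Λ = s) (hsfin : s ≠ ⊤) :
    ∫⁻ x, ENNReal.ofReal (klFun (f x).toReal) ∂Λ =
      ENNReal.ofReal (klFun s.toReal) + s * klDiv (s⁻¹ • Λ.withDensity f) Λ := by
  rcases eq_or_ne s 0 with rfl | hs0
  · rw [lintegral_eq_zero_iff hf] at hs
    have : ∫⁻ x, ENNReal.ofReal (klFun (f x).toReal) ∂Λ = ∫⁻ _, 1 ∂Λ := by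
      refine lintegral_congr_ae ?_
      filter_upwards [hs] with x hx
      simp [hx, klFun_zero]
    simp [this, klFun_zero]
  have hspos : 0 < s.toReal := ENNReal.toReal_pos hs0 hsfin
  have hy : Measurable fun x => s⁻¹ * f x := hf.const_mul _
  have hyint : ∫⁻ x, s⁻¹ * f x ∂Λ = 1 := by
    rw [lintegral_const_mul _ hf, hs, ENNReal.inv_mul_cancel hs0 hsfin]
  have hdens : s⁻¹ • Λ.withDensity f = Λ.withDensity fun x => s⁻¹ * f x :=
    (withDensity_smul _ hf).symm
  rw [hdens, klDiv_withDensity _ hy (by simp [hyint])]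
  set a := ENNReal.ofReal (s.toReal * (Real.log s.toReal)⁺)
  set b := ENNReal.ofReal (s.toReal * (Real.log s.toReal)⁻)
  have hpt : ∀ᵐ x ∂Λ, ENNReal.ofReal (klFun (f x).toReal) + (a + b * (s⁻¹ * f x)) =
      ENNReal.ofReal (klFun s.toReal) + s * ENNReal.ofReal (klFun (s⁻¹ * f x).toReal) +
        (a * (s⁻¹ * f x) + b) := by
    filter_upwards [ae_lt_top hy (by simp [hyint])] with x hx
    have := ofReal_klFun_mul_add hspos (ENNReal.toReal_nonneg (a := s⁻¹ * f x))
    rw [← ENNReal.toReal_mul, ← mul_assoc, ENNReal.mul_inv_cancel hs0 hsfin, one_mul,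
      ENNReal.ofReal_toReal hx.ne, ENNReal.ofReal_toReal hsfin] at this
    exact this
  have hint := lintegral_congr_ae hpt
  have hmk : Measurable fun x => ENNReal.ofReal (klFun (s⁻¹ * f x).toReal) := by fun_prop
  have hab : a + b ≠ ⊤ := ENNReal.add_ne_top.2 ⟨ENNReal.ofReal_ne_top, ENNReal.ofReal_ne_top⟩
  rw [lintegral_add_right _ (by fun_prop), lintegral_add_right _ (by fun_prop),
    lintegral_add_right _ (by fun_prop), lintegral_add_right _ (by fun_prop),
    lintegral_add_right _ (by fun_prop), lintegral_const_mul _ hy, lintegral_const_mul _ hy,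
    lintegral_const_mul _ hmk, hyint] at hint
  simpa [ENNReal.add_left_inj hab] using hint

/-- Chain rule for the relative entropy along a measurable map to a countable space, where `Λ t` is
the conditional law of the reference measure on the fiber over `t`. -/
lemma klDiv_eq_klDiv_map_add_tsum {Ω T : Type*} [MeasurableSpace Ω] [MeasurableSpace T]
    [Countable T] [DiscreteMeasurableSpace T] {g : Ω → T} (hg : Measurable g) {P Q : Measure Ω}
    [IsFiniteMeasure P] [IsFiniteMeasure Q] (hPQ : P ≪ Q) (Λ : T → Measure Ω)
    (hΛ : ∀ t, IsProbabilityMeasure (Λ t))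
    (hQ : ∀ t, Q.restrict (g ⁻¹' {t}) = Q (g ⁻¹' {t}) • Λ t) :
    klDiv P Q = klDiv (P.map g) (Q.map g) +
      ∑' t, P (g ⁻¹' {t}) *
        klDiv ((P (g ⁻¹' {t}))⁻¹ • P.restrict (g ⁻¹' {t})) (Λ t) := by
  have hB : ∀ t, MeasurableSet (g ⁻¹' {t}) := fun t => hg (measurableSet_singleton t)
  set f := P.rnDeriv Q
  have hf : Measurable f := Measure.measurable_rnDeriv P Q
  have hPf : P = Q.withDensity f := (Measure.withDensity_rnDeriv_eq P Q hPQ).symm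
  have hPr : ∀ t, P.restrict (g ⁻¹' {t}) = Q (g ⁻¹' {t}) • (Λ t).withDensity f := by
    intro t
    conv_lhs => rw [hPf]
    rw [restrict_withDensity (hB t), hQ, withDensity_smul_measure]
  have hPB : ∀ t, P (g ⁻¹' {t}) = Q (g ⁻¹' {t}) * ∫⁻ x, f x ∂(Λ t) := by
    intro t
    have := congrArg (fun M => M univ) (hPr t)
    simpa using this
  set h : T → ℝ≥0∞ := fun t => P (g ⁻¹' {t}) / Q (g ⁻¹' {t}) with hh
  have hPg : P.map g = (Q.map g).withDensity h := by
    rw [Measure.ext_iff_singleton]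
    intro t
    rw [withDensity_apply _ (measurableSet_singleton t), Measure.restrict_singleton,
      lintegral_smul_measure, lintegral_dirac,
      Measure.map_apply hg (measurableSet_singleton t),
      Measure.map_apply hg (measurableSet_singleton t), smul_eq_mul, hh]
    exact (ENNReal.mul_div_cancel' (fun h0 => by simp [hPB t, h0])
      (fun h0 => absurd h0 (measure_ne_top _ _))).symm
  have hfin : ∫⁻ t, h t ∂(Q.map g) ≠ ⊤ := by
    have := congrArg (fun M => M univ) hPg
    simp only [withDensity_apply _ MeasurableSet.univ, Measure.restrict_univ] at this
    rw [← this]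
    exact measure_ne_top _ _
  rw [hPg, klDiv_withDensity _ Measurable.of_discrete hfin, lintegral_countable',
    ← ENNReal.tsum_add, klDiv_eq_lintegral_klFun_of_ac hPQ, ← setLIntegral_univ,
    ← preimage_univ (f := g), ← iUnion_of_singleton T, preimage_iUnion,
    lintegral_iUnion hB (fun _ _ hne => Disjoint.preimage _ (by simpa using hne))]
  refine tsum_congr fun t => ?_
  rw [Measure.map_apply hg (measurableSet_singleton t), hQ, lintegral_smul_measure, smul_eq_mul,
    hPr]
  set c := Q (g ⁻¹' {t}) with hc
  have hcfin : c ≠ ⊤ := measure_ne_top _ _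
  rcases eq_or_ne c 0 with hc0 | hc0
  · simp [hPB t, ← hc, hc0]
  have hs : ∫⁻ x, f x ∂(Λ t) = h t := by
    simp only [hh, hPB t, ← hc]
    rw [mul_comm, ENNReal.mul_div_cancel_right hc0 hcfin]
  have hht : h t ≠ ⊤ := ENNReal.div_ne_top (measure_ne_top _ _) hc0
  have hp : P (g ⁻¹' {t}) = c * h t := by rw [hPB t, hs]
  have := hΛ t
  have hinv : (c * h t)⁻¹ * c = (h t)⁻¹ := by
    rw [ENNReal.mul_inv (Or.inl hc0) (Or.inl hcfin), mul_right_comm,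
      ENNReal.inv_mul_cancel hc0 hcfin, one_mul]
  rw [lintegral_klFun_eq_add (Λ t) hf hs hht, hp, smul_smul, hinv, mul_add, mul_assoc,
    mul_comm (ENNReal.ofReal _) c]

lemma KL_eq_coe_klDiv {Ω : Type*} [MeasurableSpace Ω] (P Q : Measure Ω)
    [IsProbabilityMeasure P] [IsProbabilityMeasure Q] : KL P Q = (klDiv P Q : EReal) := by
  unfold KL
  split_ifs with h
  · have hreal := toReal_klDiv_of_measure_eq (μ := P) (ν := Q) h.1 (by simp)
    have hne := klDiv_ne_top (μ := P) (ν := Q) h.1 h.2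
    rw [← EReal.coe_ennreal_toReal hne, hreal]
    rfl
  · rw [klDiv_eq_top_iff.2 (fun h1 h2 => h ⟨h1, h2⟩)]
    rfl

lemma erealToENNReal_coe (x : ℝ≥0∞) : erealToENNReal (x : EReal) = x := by
  unfold erealToENNReal
  split_ifs with h
  · exact (EReal.coe_ennreal_eq_top_iff.1 h).symm
  · have hx : x ≠ ⊤ := fun hx => h (by simp [hx])
    rw [← EReal.coe_ennreal_toReal hx, EReal.toReal_coe, ENNReal.ofReal_toReal hx]

lemma isProbabilityMeasure_inv_smul_restrict {Ω : Type*} [MeasurableSpace Ω] (P : Measure Ω)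
    [IsFiniteMeasure P] {B : Set Ω} (hB : P B ≠ 0) :
    IsProbabilityMeasure ((P B)⁻¹ • P.restrict B) :=
  ⟨by simp [ENNReal.inv_mul_cancel hB (measure_ne_top P B)]⟩

lemma restrict_sum_smul_eq_smul {X A : Type*} [MeasurableSpace X] {I : A → Set X}
    (hImeas : ∀ α, MeasurableSet (I α)) (hIdisj : Pairwise (Function.onFun Disjoint I))
    {lam : A → Measure X} (hlam : ∀ α, IsProbabilityMeasure (lam α))
    (hlamconc : ∀ α, lam α (I α) = 1) (m : A → ℝ≥0∞) (α : A) :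
    (Measure.sum (fun α => m α • lam α)).restrict (I α) = m α • lam α := by
  have hcompl : ∀ β, lam β (I β)ᶜ = 0 := fun β => by
    have := hlam β
    rw [prob_compl_eq_zero_iff (hImeas β)]
    exact hlamconc β
  ext s hs
  rw [Measure.restrict_apply hs, Measure.sum_apply _ (hs.inter (hImeas α)), tsum_eq_single α]
  · simp only [Measure.smul_apply, smul_eq_mul]
    rw [measure_inter_conull (hcompl α)]
  · intro β hβ
    have : lam β (s ∩ I α) = 0 :=
      measure_mono_null (fun x hx hxβ => (hIdisj hβ).le_bot ⟨hxβ, hx.2⟩) (hcompl β)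
    simp [this]

/-- **Coarse-graining of cost and relative entropy** (Lemma 4.4): for a Polish space `X`
partitioned into countably many Borel atoms `(I_α)`, `λ_α` probability measures
concentrated on `I_α`, `μ = ∑ m_α λ_α`, label map `ℓ`, and block-constant cost
`C(x,y) = Ĉ(ℓx, ℓy)`: (1) `∫ C dP = ∑ Ĉ(α,β) P̂(α,β)`; (2) `KL(P‖μ⊗μ) ≥ KL(P̂‖μ̂⊗μ̂)`;
(3) if `KL(P‖μ⊗μ) < ∞` then `P ≪ μ⊗μ`, the chain-rule decomposition holds, and
equality `KL(P‖μ⊗μ) = KL(P̂‖μ̂⊗μ̂)` holds iff each conditional is `λ_α ⊗ λ_β`. -/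
theorem coarse_graining_cost_and_entropy
    {X : Type*} [MetricSpace X] [PolishSpace X] [MeasurableSpace X] [BorelSpace X]
    {A : Type*} [Countable A] [MeasurableSpace A] [DiscreteMeasurableSpace A]
    (I : A → Set X) (hImeas : ∀ α, MeasurableSet (I α))
    (hIdisj : Pairwise (Function.onFun Disjoint I)) (hIcover : (⋃ α, I α) = univ)
    (lam : A → Measure X) (hlam : ∀ α, IsProbabilityMeasure (lam α))
    (hlamconc : ∀ α, lam α (I α) = 1)
    (m : A → ℝ≥0∞) (hm : ∑' α, m α = 1)
    (μ : Measure X) (hμ : μ = Measure.sum (fun α => m α • lam α))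
    (ℓ : X → A) (hℓmeas : Measurable ℓ) (hℓ : ∀ α, ∀ x ∈ I α, ℓ x = α)
    (Chat : A × A → ℝ) (hChat : ∀ q, 0 ≤ Chat q)
    (P : Measure (X × X)) (hP : P ∈ couplings μ μ) :
    (∫⁻ p, ENNReal.ofReal (Chat (ℓ p.1, ℓ p.2)) ∂P) =
      (∑' q : A × A, ENNReal.ofReal (Chat q) * (P.map (Prod.map ℓ ℓ)) {q}) ∧
    KL (P.map (Prod.map ℓ ℓ)) ((μ.map ℓ).prod (μ.map ℓ)) ≤ KL P (μ.prod μ) ∧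
    (KL P (μ.prod μ) < (⊤ : EReal) →
      (P ≪ μ.prod μ ∧
       KL P (μ.prod μ) =
         KL (P.map (Prod.map ℓ ℓ)) ((μ.map ℓ).prod (μ.map ℓ)) +
           ((∑' q : A × A,
              (P.map (Prod.map ℓ ℓ)) {q} *
                erealToENNReal
                  (KL ((P (I q.1 ×ˢ I q.2))⁻¹ • P.restrict (I q.1 ×ˢ I q.2))
                    ((lam q.1).prod (lam q.2))) : ℝ≥0∞) : EReal) ∧
       (KL P (μ.prod μ) = KL (P.map (Prod.map ℓ ℓ)) ((μ.map ℓ).prod (μ.map ℓ)) ↔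
         ∀ q : A × A, (P.map (Prod.map ℓ ℓ)) {q} ≠ 0 →
           (P (I q.1 ×ˢ I q.2))⁻¹ • P.restrict (I q.1 ×ˢ I q.2) =
             (lam q.1).prod (lam q.2)))) := by
  obtain ⟨hPprob, -, -⟩ := hP
  have hg : Measurable (Prod.map ℓ ℓ) := hℓmeas.prodMap hℓmeas
  have hpre1 : ∀ α, ℓ ⁻¹' {α} = I α := by
    intro α
    ext x
    refine ⟨fun hx => ?_, fun hx => hℓ α x hx⟩
    obtain ⟨β, hβ⟩ := mem_iUnion.1 (hIcover ▸ mem_univ x : x ∈ ⋃ α, I α)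
    rw [← show ℓ x = α from hx, hℓ β x hβ]
    exact hβ
  have hpre : ∀ q : A × A, Prod.map ℓ ℓ ⁻¹' {q} = I q.1 ×ˢ I q.2 := by
    intro q
    rw [← hpre1, ← hpre1, ← singleton_prod_singleton, preimage_prod_map_prod]
  have hPhat : ∀ q, P.map (Prod.map ℓ ℓ) {q} = P (I q.1 ×ˢ I q.2) := fun q => by
    rw [Measure.map_apply hg (measurableSet_singleton q), hpre]
  have hμI : ∀ α, μ.restrict (I α) = m α • lam α := fun α => by
    rw [hμ]
    exact restrict_sum_smul_eq_smul hImeas hIdisj hlam hlamconc m α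
  have hμprob : IsProbabilityMeasure μ := ⟨by
    rw [hμ, Measure.sum_apply _ MeasurableSet.univ]
    simpa using hm⟩
  have hrest : ∀ q : A × A, (μ.prod μ).restrict (Prod.map ℓ ℓ ⁻¹' {q}) =
      (μ.prod μ) (Prod.map ℓ ℓ ⁻¹' {q}) • (lam q.1).prod (lam q.2) := by
    intro q
    have hmass : ∀ α, μ (I α) = m α := fun α => by
      simpa using congrArg (fun M => M univ) (hμI α)
    rw [hpre, ← Measure.prod_restrict, hμI, hμI, Measure.prod_prod, hmass, hmass,
      Measure.prod_smul_left, Measure.prod_smul_right, smul_smul]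
  have hchain : P ≪ μ.prod μ → klDiv P (μ.prod μ) =
      klDiv (P.map (Prod.map ℓ ℓ)) ((μ.prod μ).map (Prod.map ℓ ℓ)) +
        ∑' q : A × A, P (I q.1 ×ˢ I q.2) *
          klDiv ((P (I q.1 ×ˢ I q.2))⁻¹ • P.restrict (I q.1 ×ˢ I q.2))
            ((lam q.1).prod (lam q.2)) := fun hac => by
    simpa only [hpre] using klDiv_eq_klDiv_map_add_tsum hg hac
      (fun q => (lam q.1).prod (lam q.2)) (fun q => inferInstance) hrest
  have : IsProbabilityMeasure (P.map (Prod.map ℓ ℓ)) :=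
    Measure.isProbabilityMeasure_map hg.aemeasurable
  have : IsProbabilityMeasure ((μ.prod μ).map (Prod.map ℓ ℓ)) :=
    Measure.isProbabilityMeasure_map hg.aemeasurable
  rw [Measure.map_prod_map μ μ hℓmeas hℓmeas, KL_eq_coe_klDiv, KL_eq_coe_klDiv]
  refine ⟨?_, ?_, fun hfin => ?_⟩
  · rw [← lintegral_countable' (μ := P.map (Prod.map ℓ ℓ)) (fun q => ENNReal.ofReal (Chat q)),
      lintegral_map Measurable.of_discrete hg]
    rfl
  · rw [EReal.coe_ennreal_le_coe_ennreal_iff]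
    by_cases hac : P ≪ μ.prod μ
    · rw [hchain hac]
      exact le_self_add
    · rw [klDiv_of_not_ac hac]
      exact le_top
  · have hne : klDiv P (μ.prod μ) ≠ ⊤ := fun h => by simp [h] at hfin
    have hac : P ≪ μ.prod μ := (klDiv_ne_top_iff.1 hne).1
    have hsum : (∑' q : A × A, (P.map (Prod.map ℓ ℓ)) {q} *
        erealToENNReal (KL ((P (I q.1 ×ˢ I q.2))⁻¹ • P.restrict (I q.1 ×ˢ I q.2))
          ((lam q.1).prod (lam q.2)))) =
        ∑' q : A × A, P (I q.1 ×ˢ I q.2) *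
          klDiv ((P (I q.1 ×ˢ I q.2))⁻¹ • P.restrict (I q.1 ×ˢ I q.2))
            ((lam q.1).prod (lam q.2)) := by
      refine tsum_congr fun q => ?_
      rw [hPhat]
      rcases eq_or_ne (P (I q.1 ×ˢ I q.2)) 0 with h0 | h0
      · simp [h0]
      · have := isProbabilityMeasure_inv_smul_restrict P h0
        rw [KL_eq_coe_klDiv, erealToENNReal_coe]
    refine ⟨hac, ?_, ?_⟩
    · rw [hsum, ← EReal.coe_ennreal_add, ← hchain hac]
    · rw [EReal.coe_ennreal_eq_coe_ennreal_iff]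
      have hne' : klDiv (P.map (Prod.map ℓ ℓ)) ((μ.prod μ).map (Prod.map ℓ ℓ)) ≠ ⊤ :=
        ne_top_of_le_ne_top hne (by rw [hchain hac]; exact le_self_add)
      rw [hchain hac]
      nth_rw 2 [← add_zero (klDiv (P.map _) _)]
      rw [ENNReal.add_right_inj hne', ENNReal.tsum_eq_zero]
      refine forall_congr' fun q => ?_
      rw [hPhat, mul_eq_zero, or_iff_not_imp_left]
      refine forall_congr' fun h0 => ?_
      have := isProbabilityMeasure_inv_smul_restrict P h0
      exact klDiv_eq_zero_iff

end
end
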